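/- Let C ≥ 0 and γ ∈ [0,1], let (a_{i,j})_{i,j≥1} be nonnegative real numbers with a_{i,j} = a_{j,i} and a_{i,j} ≤ C(i^γ + j^γ) for all i,j ≥ 1, let (c_i)_{i≥1} be nonnegative real numbers such that the family ((i+j)^k a_{i,j} c_i c_j)_{i,j≥1} is summable, let k ≥ 2 be an integer and I a positive integer. Then (1/2) ∑_{i=1}^∞ ∑_{j=1}^∞ a_{i,j} c_i c_j ( (i+j)^k·1_{i+j≥I} − i^k·1_{i≥I} − j^k·1_{j≥I} ) ≤ C ∑_{l=1}^{k−1} binom(k,l) ρ_{γ+l} ρ_{k−l} + C (∑_{i=1}^{I−1} i^{γ+k} c_i) ρ_0 + C (∑_{i=1}^{I−1} i^k c_i) ρ_γ, where ρ_s = ∑_{i=1}^∞ i^s c_i is the moment of order s (taken in [0,+∞]) and 1_P denotes the indicator of condition P. -/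

import Mathlib

open ENNReal

theorem add_pow_eq_sum_Icc_add_pow_add_pow {R : Type*} [CommSemiring R] (x y : R) {k : ℕ}
    (hk : 1 ≤ k) :
    (x + y) ^ k = ∑ l ∈ Finset.Icc 1 (k - 1), (Nat.choose k l : R) * x ^ l * y ^ (k - l)
      + x ^ k + y ^ k := by
  obtain ⟨n, rfl⟩ : ∃ n, k = n + 1 := ⟨k - 1, by omega⟩
  have hIcc : Finset.Icc 1 (n + 1 - 1) = Finset.Ico 1 (n + 1) := by
    ext; simp only [Finset.mem_Icc, Finset.mem_Ico]; omega
  rw [add_pow, Finset.sum_range_succ, Finset.range_eq_Ico,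
    Finset.sum_eq_sum_Ico_succ_bot (Nat.succ_pos n), hIcc]
  have hcomm : ∀ l ∈ Finset.Ico 1 (n + 1),
      (Nat.choose (n + 1) l : R) * x ^ l * y ^ (n + 1 - l)
        = x ^ l * y ^ (n + 1 - l) * (Nat.choose (n + 1) l : R) := fun l _ => by ring
  rw [Finset.sum_congr rfl hcomm]
  simp
  ring

theorem tail_add_pow_sub_le (k I i j : ℕ) (hk : 1 ≤ k) :
    ((i + j : ℕ) : ℝ) ^ k * (if I ≤ i + j then 1 else 0)
        - (i : ℝ) ^ k * (if I ≤ i then 1 else 0) - (j : ℝ) ^ k * (if I ≤ j then 1 else 0)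
      ≤ ∑ l ∈ Finset.Icc 1 (k - 1), (Nat.choose k l : ℝ) * (i : ℝ) ^ l * (j : ℝ) ^ (k - l)
        + (i : ℝ) ^ k * (if i < I then 1 else 0) + (j : ℝ) ^ k * (if j < I then 1 else 0) := by
  push_cast
  rw [add_pow_eq_sum_Icc_add_pow_add_pow (i : ℝ) (j : ℝ) hk]
  have hQ : 0 ≤ ∑ l ∈ Finset.Icc 1 (k - 1),
      (Nat.choose k l : ℝ) * (i : ℝ) ^ l * (j : ℝ) ^ (k - l) :=
    Finset.sum_nonneg fun l _ => by positivity
  have hi : 0 ≤ (i : ℝ) ^ k := by positivity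
  have hj : 0 ≤ (j : ℝ) ^ k := by positivity
  split_ifs <;> first | omega | linarith

theorem sum_Icc_one_sub_one_eq_tsum (f : ℕ → ℝ≥0∞) (I : ℕ) :
    ∑ i ∈ Finset.Icc 1 (I - 1), f i = ∑' i : ℕ, if i + 1 < I then f (i + 1) else 0 := by
  rw [tsum_eq_sum (s := Finset.range (I - 1))]
  · have hIcc : Finset.Icc 1 (I - 1) = Finset.Ico 1 (I - 1 + 1) := by
      ext; simp only [Finset.mem_Icc, Finset.mem_Ico]; omega
    rw [hIcc, Finset.sum_Ico_eq_sum_range]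
    refine Finset.sum_congr (by simp) fun i hi => ?_
    rw [if_pos (by simp at hi; omega), add_comm]
  · intro i hi
    rw [if_neg (by simp at hi; omega)]

theorem ENNReal.tsum_mul_prod {α β : Type*} (f : α → ℝ≥0∞) (g : β → ℝ≥0∞) :
    ∑' p : α × β, f p.1 * g p.2 = (∑' i, f i) * ∑' j, g j := by
  rw [ENNReal.tsum_prod (f := fun i j => f i * g j)]
  simp_rw [ENNReal.tsum_mul_left, ENNReal.tsum_mul_right]

/-- A sum over pairs that is termwise dominated by the symmetrization of `F` has half its value
bounded by the sum of `F`. -/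
theorem ENNReal.half_tsum_prod_le {α : Type*} (G F : α × α → ℝ≥0∞)
    (h : ∀ p, G p ≤ F p + F p.swap) :
    (1 / 2 : ℝ≥0∞) * ∑' p, G p ≤ ∑' p, F p := by
  have hswap : ∑' p : α × α, F p.swap = ∑' p, F p := (Equiv.prodComm α α).tsum_eq F
  calc (1 / 2 : ℝ≥0∞) * ∑' p, G p ≤ 1 / 2 * ∑' p, (F p + F p.swap) := by
        gcongr with p; exact h p
    _ = 1 / 2 * (2 * ∑' p, F p) := by rw [ENNReal.tsum_add, hswap, two_mul]
    _ = ∑' p, F p := by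
        rw [← mul_assoc, one_div, ENNReal.inv_mul_cancel two_ne_zero ofNat_ne_top, one_mul]

theorem ofReal_rpow_mul_binomial_tail (γ u v : ℝ) (k I i j : ℕ) (hi : 1 ≤ i)
    (hu : 0 ≤ u) (hv : 0 ≤ v) :
    ENNReal.ofReal ((i : ℝ) ^ γ *
        (∑ l ∈ Finset.Icc 1 (k - 1), (Nat.choose k l : ℝ) * (i : ℝ) ^ l * (j : ℝ) ^ (k - l)
        + (i : ℝ) ^ k * (if i < I then 1 else 0) + (j : ℝ) ^ k * (if j < I then 1 else 0))
        * u * v)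
      = ∑ l ∈ Finset.Icc 1 (k - 1), (Nat.choose k l : ℝ≥0∞) *
          (ENNReal.ofReal ((i : ℝ) ^ (γ + (l : ℝ)) * u) *
            ENNReal.ofReal ((j : ℝ) ^ (k - l) * v))
        + (if i < I then ENNReal.ofReal ((i : ℝ) ^ (γ + (k : ℝ)) * u) else 0) * ENNReal.ofReal v
        + ENNReal.ofReal ((i : ℝ) ^ γ * u) *
          (if j < I then ENNReal.ofReal ((j : ℝ) ^ k * v) else 0) := by
  have hi0 : (0 : ℝ) < i := by exact_mod_cast hi
  have hpow (l : ℕ) : (i : ℝ) ^ (γ + (l : ℝ)) = (i : ℝ) ^ γ * (i : ℝ) ^ l := by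
    rw [Real.rpow_add hi0, Real.rpow_natCast]
  have hif (P : Prop) [Decidable P] (x : ℝ) :
      (if P then ENNReal.ofReal x else 0) = ENNReal.ofReal (x * if P then 1 else 0) := by
    split_ifs <;> simp
  have hnn (P : Prop) [Decidable P] : (0 : ℝ) ≤ if P then 1 else 0 := by
    split_ifs <;> norm_num
  have h₁ := hnn (i < I)
  have h₂ := hnn (j < I)
  have hterm (l : ℕ) : (Nat.choose k l : ℝ≥0∞) *
          (ENNReal.ofReal ((i : ℝ) ^ (γ + (l : ℝ)) * u) *
            ENNReal.ofReal ((j : ℝ) ^ (k - l) * v))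
      = ENNReal.ofReal ((Nat.choose k l : ℝ) *
          ((i : ℝ) ^ (γ + (l : ℝ)) * u * ((j : ℝ) ^ (k - l) * v))) := by
    rw [← ENNReal.ofReal_mul (by positivity), ← ENNReal.ofReal_natCast,
      ← ENNReal.ofReal_mul (by positivity)]
  rw [Finset.sum_congr rfl fun l _ => hterm l,
    ← ENNReal.ofReal_sum_of_nonneg fun l _ => by positivity, hif, hif,
    ← ENNReal.ofReal_mul (by positivity), ← ENNReal.ofReal_mul (by positivity),
    ← ENNReal.ofReal_add (Finset.sum_nonneg fun l _ => by positivity) (by positivity),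
    ← ENNReal.ofReal_add
      (add_nonneg (Finset.sum_nonneg fun l _ => by positivity) (by positivity)) (by positivity)]
  congr 1
  simp_rw [hpow, mul_add, add_mul, Finset.mul_sum, Finset.sum_mul]
  congr 1
  · congr 1
    · exact Finset.sum_congr rfl fun l _ => by ring
    · ring
  · ring

/-- Fundamental estimate (26), controlling the source term of the tail moment of order
`k ≥ 2`, with sums taken in `[0,+∞]`: for symmetric coefficients
`0 ≤ a_{i,j} ≤ C(i^γ + j^γ)`,
`(1/2) ∑_{i,j≥1} a_{i,j} c_i c_j ((i+j)^k 1_{i+j≥I} − i^k 1_{i≥I} − j^k 1_{j≥I})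
  ≤ C ∑_{l=1}^{k−1} C(k,l) ρ_{γ+l} ρ_{k−l}
    + C (∑_{i=1}^{I−1} i^{γ+k} c_i) ρ_0 + C (∑_{i=1}^{I−1} i^k c_i) ρ_γ`. -/
theorem tail_moment_source_estimate (C : ℝ) (hC : 0 ≤ C)
    (γ : ℝ) (hγ0 : 0 ≤ γ) (hγ1 : γ ≤ 1)
    (a : ℕ → ℕ → ℝ) (ha : ∀ i j, 1 ≤ i → 1 ≤ j → 0 ≤ a i j)
    (hsym : ∀ i j, 1 ≤ i → 1 ≤ j → a i j = a j i)
    (hbd : ∀ i j, 1 ≤ i → 1 ≤ j → a i j ≤ C * ((i : ℝ) ^ γ + (j : ℝ) ^ γ))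
    (c : ℕ → ℝ) (hc : ∀ i, 1 ≤ i → 0 ≤ c i)
    (k : ℕ) (hk : 2 ≤ k) (I : ℕ) (hI : 1 ≤ I)
    (hsum : Summable (fun p : ℕ × ℕ =>
      ((p.1 + 1 + (p.2 + 1) : ℕ) : ℝ) ^ k *
        a (p.1 + 1) (p.2 + 1) * c (p.1 + 1) * c (p.2 + 1))) :
    (1 / 2 : ℝ≥0∞) * ∑' p : ℕ × ℕ, ENNReal.ofReal
        (a (p.1 + 1) (p.2 + 1) * c (p.1 + 1) * c (p.2 + 1) *
          (((p.1 + 1 + (p.2 + 1) : ℕ) : ℝ) ^ k *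
              (if I ≤ p.1 + 1 + (p.2 + 1) then 1 else 0)
            - ((p.1 + 1 : ℕ) : ℝ) ^ k * (if I ≤ p.1 + 1 then 1 else 0)
            - ((p.2 + 1 : ℕ) : ℝ) ^ k * (if I ≤ p.2 + 1 then 1 else 0)))
      ≤ ENNReal.ofReal C *
          (∑ l ∈ Finset.Icc 1 (k - 1), (Nat.choose k l : ℝ≥0∞) *
            (∑' i : ℕ, ENNReal.ofReal (((i + 1 : ℕ) : ℝ) ^ (γ + (l : ℝ)) * c (i + 1))) *
            (∑' i : ℕ, ENNReal.ofReal (((i + 1 : ℕ) : ℝ) ^ (k - l) * c (i + 1))))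
        + ENNReal.ofReal C *
            (∑ i ∈ Finset.Icc 1 (I - 1), ENNReal.ofReal ((i : ℝ) ^ (γ + (k : ℝ)) * c i)) *
            (∑' i : ℕ, ENNReal.ofReal (c (i + 1)))
        + ENNReal.ofReal C *
            (∑ i ∈ Finset.Icc 1 (I - 1), ENNReal.ofReal ((i : ℝ) ^ k * c i)) *
            (∑' i : ℕ, ENNReal.ofReal (((i + 1 : ℕ) : ℝ) ^ γ * c (i + 1))) := by
  let x : ℕ → ℝ := fun i => ((i + 1 : ℕ) : ℝ)
  let S : ℕ → ℕ → ℝ := fun i j =>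
    ∑ l ∈ Finset.Icc 1 (k - 1), (Nat.choose k l : ℝ) * (x i) ^ l * (x j) ^ (k - l)
      + (x i) ^ k * (if i + 1 < I then 1 else 0) + (x j) ^ k * (if j + 1 < I then 1 else 0)
  have hS_nonneg (i j : ℕ) : 0 ≤ S i j := by
    refine add_nonneg (add_nonneg (Finset.sum_nonneg fun l _ => by positivity) ?_) ?_ <;>
      split_ifs <;> positivity
  have hS_symm (i j : ℕ) : S j i = S i j := by
    have h₁ := add_pow_eq_sum_Icc_add_pow_add_pow (x i) (x j) (k := k) (by omega)
    have h₂ := add_pow_eq_sum_Icc_add_pow_add_pow (x j) (x i) (k := k) (by omega)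
    rw [add_comm (x j)] at h₂
    simp only [S]
    linarith
  have hc' (i : ℕ) : 0 ≤ c (i + 1) := hc _ (by omega)
  let F : ℕ × ℕ → ℝ≥0∞ := fun p => ENNReal.ofReal C *
    ENNReal.ofReal (x p.1 ^ γ * S p.1 p.2 * c (p.1 + 1) * c (p.2 + 1))
  refine (ENNReal.half_tsum_prod_le _ F ?_).trans_eq ?_
  · rintro ⟨i, j⟩
    have hi := hc' i
    have hj := hc' j
    have hSij := hS_nonneg i j
    simp only [F, Prod.swap, hS_symm i j]
    rw [← mul_add, ← ENNReal.ofReal_add (by positivity) (by positivity), ← ENNReal.ofReal_mul hC]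
    refine ENNReal.ofReal_le_ofReal ?_
    have ha' := ha (i + 1) (j + 1) (by omega) (by omega)
    calc _ ≤ a (i + 1) (j + 1) * c (i + 1) * c (j + 1) * S i j :=
          mul_le_mul_of_nonneg_left (tail_add_pow_sub_le k I (i + 1) (j + 1) (by omega))
            (by positivity)
      _ ≤ C * (x i ^ γ + x j ^ γ) * c (i + 1) * c (j + 1) * S i j := by
          gcongr
          exact hbd (i + 1) (j + 1) (by omega) (by omega)
      _ = _ := by ring
  · have hF (p : ℕ × ℕ) := ofReal_rpow_mul_binomial_tail γ (c (p.1 + 1)) (c (p.2 + 1)) k I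
      (p.1 + 1) (p.2 + 1) (by omega) (hc' _) (hc' _)
    simp only [F, S, x, hF]
    rw [ENNReal.tsum_mul_left, ENNReal.tsum_add, ENNReal.tsum_add,
      Summable.tsum_finsetSum fun _ _ => ENNReal.summable]
    simp_rw [ENNReal.tsum_mul_left]
    rw [ENNReal.tsum_mul_prod
        (fun i => if i + 1 < I then
          ENNReal.ofReal (((i + 1 : ℕ) : ℝ) ^ (γ + (k : ℝ)) * c (i + 1)) else 0)
        (fun j => ENNReal.ofReal (c (j + 1))),
      ENNReal.tsum_mul_prod
        (fun i => ENNReal.ofReal (((i + 1 : ℕ) : ℝ) ^ γ * c (i + 1)))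
        (fun j => if j + 1 < I then
          ENNReal.ofReal (((j + 1 : ℕ) : ℝ) ^ k * c (j + 1)) else 0),
      sum_Icc_one_sub_one_eq_tsum (I := I), sum_Icc_one_sub_one_eq_tsum (I := I),
      Finset.sum_congr rfl fun l _ => congrArg ((Nat.choose k l : ℝ≥0∞) * ·)
        (ENNReal.tsum_mul_prod
          (fun i => ENNReal.ofReal (((i + 1 : ℕ) : ℝ) ^ (γ + (l : ℝ)) * c (i + 1)))
          (fun j => ENNReal.ofReal (((j + 1 : ℕ) : ℝ) ^ (k - l) * c (j + 1))))]
    simp only [mul_add, mul_assoc]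
    congr 2
    exact mul_comm _ _
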